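/- Let p ≥ 5 be a prime, let n ≥ 1, set k = 2n + 1, and let χ be a primitive Dirichlet character of conductor p^k. Let ℓ be an integer with p ∤ ℓ such that χ(1 + p^n x) = e_{p^{n+1}}(ℓ (x − b p^n x²)) for all integers x, where b is an integer with 2b ≡ 1 (mod p^{n+1}). Then for every integer t₀ with t₀ ≡ −ℓ (mod p^n), one has τ(χ) = ε_p · p^{n + 1/2} · (−2ℓ | p) · χ(t₀) · e_{p^k}(t₀) · e_p( c · ((ℓ + t₀)/p^n)² ), where (· | p) is the Legendre symbol and c is an integer with 2 ℓ c ≡ 1 (mod p). -/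

import Mathlib

open Complex

/-- `eN q x = e^{2πix/q}`. -/
noncomputable def eN (q : ℕ) (x : ℤ) : ℂ := Complex.exp (2 * Real.pi * Complex.I * x / q)

/-- `εp = 1` if `p ≡ 1 (mod 4)`, and `εp = i` if `p ≡ 3 (mod 4)`. -/
noncomputable def epsFactor (q : ℕ) : ℂ := if q % 4 = 1 then 1 else Complex.I

/-- Summing over residues modulo `N` is summing over `0, …, N - 1`. -/
lemma sum_range_natCast_zmod {M : Type*} [AddCommMonoid M] (N : ℕ) [NeZero N] (f : ZMod N → M) :
    ∑ j ∈ Finset.range N, f (j : ZMod N) = ∑ x, f x := by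
  refine Finset.sum_bij' (fun j _ ↦ (j : ZMod N)) (fun x _ ↦ x.val) ?_ ?_ ?_ ?_ ?_
  · simp
  · intro x _; simpa using ZMod.val_lt x
  · intro j hj; exact ZMod.val_cast_of_lt (by simpa using hj)
  · intro x _; simp
  · simp

open Polynomial in
lemma sum_eval_eq_neg_coeff {F : Type*} [Field F] [Fintype F] (g : F[X])
    (hg : g.natDegree = Fintype.card F - 1) :
    ∑ x, g.eval x = -g.coeff (Fintype.card F - 1) := by
  classical
  have h1 : 1 < Fintype.card F := Fintype.one_lt_card
  simp_rw [eval_eq_sum_range, hg]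
  rw [Finset.sum_comm, Finset.sum_range_succ, Finset.sum_eq_zero, zero_add, ← Finset.mul_sum]
  · have : ∑ x : F, x ^ (Fintype.card F - 1) = -1 := by
      have h : ∀ x : F, x ^ (Fintype.card F - 1) = 1 - if x = 0 then 1 else 0 := by
        intro x
        split_ifs with hx
        · subst hx; rw [zero_pow (by lia), sub_self]
        · rw [FiniteField.pow_card_sub_one_eq_one x hx, sub_zero]
      simp [h]
    rw [this]; ring
  · intro i hi
    rw [← Finset.mul_sum, FiniteField.sum_pow_lt_card_sub_one _ _ (by simpa using hi), mul_zero]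

open Polynomial in
lemma sum_pow_mul_descFactorial (p m : ℕ) [Fact p.Prime] (hpm : p = 2 * m + 1) :
    ∑ j ∈ Finset.range p, (j : ZMod p) ^ m * (j.descFactorial m : ZMod p) = -1 := by
  have hmon : (X ^ m * descPochhammer (ZMod p) m).Monic :=
    (monic_X_pow m).mul (monic_descPochhammer (ZMod p) m)
  have hdeg : (X ^ m * descPochhammer (ZMod p) m).natDegree = Fintype.card (ZMod p) - 1 := by
    rw [(monic_X_pow m).natDegree_mul (monic_descPochhammer (ZMod p) m), natDegree_X_pow,
      descPochhammer_natDegree, ZMod.card]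
    lia
  have h := sum_eval_eq_neg_coeff _ hdeg
  rw [← hdeg, hmon.coeff_natDegree] at h
  rw [← h, ← sum_range_natCast_zmod]
  simp [descPochhammer_eval_eq_descFactorial]

lemma prod_range_two_mul {M : Type*} [CommMonoid M] (f : ℕ → M) (m : ℕ) :
    ∏ j ∈ Finset.range (2 * m), f j =
      (∏ k ∈ Finset.range m, f (2 * k)) * ∏ k ∈ Finset.range m, f (2 * k + 1) := by
  induction m with
  | zero => simp
  | succ m ih =>
    rw [mul_add_one, Finset.prod_range_succ, Finset.prod_range_succ, ih, Finset.prod_range_succ,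
      Finset.prod_range_succ]
    ac_rfl

lemma factorial_mul_prod_odd (m : ℕ) :
    m.factorial * ∏ k ∈ Finset.range m, (2 * (2 * k + 1)) = (2 * m).factorial := by
  rw [← Finset.prod_range_add_one_eq_factorial (2 * m), prod_range_two_mul,
    ← Finset.prod_range_add_one_eq_factorial m, Finset.prod_mul_distrib, mul_left_comm,
    ← mul_assoc, ← Finset.prod_mul_distrib, mul_comm]
  congr 1

open Polynomial in
/-- The lowest coefficient of `∏ ((1 + X) ^ (2 k + 1) - (1 + X) ^ (p - (2 k + 1)))` modulo `p`. -/
lemma coeff_prod_one_add_X_pow_sub (p m : ℕ) (hpm : p = 2 * m + 1) :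
    (∏ k ∈ Finset.range m,
      ((1 + X : (ZMod p)[X]) ^ (2 * k + 1) - (1 + X) ^ (p - (2 * k + 1)))).coeff m =
      ∏ k ∈ Finset.range m, (2 * (2 * k + 1) : ZMod p) := by
  have key : ∀ k ∈ Finset.range m, ∃ g : (ZMod p)[X],
      (1 + X : (ZMod p)[X]) ^ (2 * k + 1) - (1 + X) ^ (p - (2 * k + 1)) = X * g ∧
        g.coeff 0 = 2 * (2 * k + 1) := by
    intro k hk
    have hk' : 2 * k + 1 ≤ p := by have := Finset.mem_range.1 hk; lia
    set f := (1 + X : (ZMod p)[X]) ^ (2 * k + 1) - (1 + X) ^ (p - (2 * k + 1)) with hf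
    have h0 : f.coeff 0 = 0 := by simp [hf, coeff_one_add_X_pow]
    obtain ⟨g, hg⟩ := X_dvd_iff.2 h0
    refine ⟨g, hg, ?_⟩
    rw [← coeff_X_mul, ← hg, hf, coeff_sub, coeff_one_add_X_pow, coeff_one_add_X_pow]
    simp [Nat.cast_sub hk']
    ring
  choose! g hg hg0 using key
  rw [Finset.prod_congr rfl hg, Finset.prod_mul_distrib, Finset.prod_const, Finset.card_range,
    coeff_X_pow_mul', if_pos le_rfl, Nat.sub_self, coeff_zero_prod]
  exact Finset.prod_congr rfl hg0

open Polynomial in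
/-- Kronecker's congruence argument fixing the sign of the quadratic Gauss sum. -/
lemma eq_one_of_sum_legendreSym_eq (p m : ℕ) [Fact p.Prime] (hpm : p = 2 * m + 1) {ζ : ℂ}
    (hζ : IsPrimitiveRoot ζ p) (s : ℤ)
    (h : ∑ j ∈ Finset.range p, (legendreSym p j : ℂ) * ζ ^ j =
      s * ∏ k ∈ Finset.range m, (ζ ^ (2 * k + 1) - ζ ^ (p - (2 * k + 1)))) :
    (s : ZMod p) = 1 := by
  have hp : p.Prime := Fact.out
  have hm : m ≠ 0 := by rintro rfl; exact hp.one_lt.ne' (by simpa using hpm)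
  set f : ℤ[X] := ∑ j ∈ Finset.range p, C (legendreSym p j) * X ^ j -
    C s * ∏ k ∈ Finset.range m, (X ^ (2 * k + 1) - X ^ (p - (2 * k + 1))) with hf
  have hroot : aeval ζ f = 0 := by
    simp [hf, h, aeval_sub, map_sum, map_prod]
  have hdvd : cyclotomic p ℤ ∣ f := by
    rw [cyclotomic_eq_minpoly hζ hp.pos]
    exact minpoly.isIntegrallyClosed_dvd (hζ.isIntegral hp.pos) hroot
  have hdvd2 : (X - 1 : (ZMod p)[X]) ^ (p - 1) ∣ f.map (Int.castRingHom (ZMod p)) := by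
    have := Polynomial.map_dvd (Int.castRingHom (ZMod p)) hdvd
    have hcyc : cyclotomic (1 * p) (ZMod p) = cyclotomic 1 (ZMod p) ^ (p - 1) :=
      cyclotomic_mul_prime_eq_pow_of_not_dvd _ (by simpa using hp.one_lt.ne')
    rw [one_mul, cyclotomic_one] at hcyc
    rwa [map_cyclotomic, hcyc] at this
  have hdvd3 : (X : (ZMod p)[X]) ^ (p - 1) ∣ (f.map (Int.castRingHom (ZMod p))).comp (1 + X) := by
    obtain ⟨g, hg⟩ := hdvd2
    rw [hg]
    refine ⟨g.comp (1 + X), ?_⟩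
    simp
  have hcoeff := X_pow_dvd_iff.1 hdvd3 m (by lia)
  have hcomp : (f.map (Int.castRingHom (ZMod p))).comp (1 + X) =
      ∑ j ∈ Finset.range p, C ((j : ZMod p) ^ m) * (1 + X) ^ j -
      C (s : ZMod p) * ∏ k ∈ Finset.range m,
        ((1 + X) ^ (2 * k + 1) - (1 + X) ^ (p - (2 * k + 1))) := by
    have hleg (j : ℕ) : ((legendreSym p j : ℤ) : (ZMod p)[X]) = (j : (ZMod p)[X]) ^ m := by
      have h := congrArg (C : ZMod p → (ZMod p)[X]) (legendreSym.eq_pow p j)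
      rw [show p / 2 = m by lia] at h
      simpa using h
    simp [hf, Polynomial.map_sum, Polynomial.map_prod, prod_comp, hleg]
  rw [hcomp, coeff_sub, finsetSum_coeff, coeff_C_mul, coeff_prod_one_add_X_pow_sub p m hpm] at hcoeff
  simp_rw [coeff_C_mul, coeff_one_add_X_pow] at hcoeff
  have h1 := congrArg (fun x ↦ (m.factorial : ZMod p) * x) hcoeff
  have h2 := sum_pow_mul_descFactorial p m hpm
  simp_rw [Nat.descFactorial_eq_factorial_mul_choose, Nat.cast_mul,
    mul_left_comm _ (m.factorial : ZMod p)] at h2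
  rw [← Finset.mul_sum] at h2
  have h3 : (m.factorial : ZMod p) * ∏ k ∈ Finset.range m, (2 * (2 * k + 1) : ZMod p) = -1 := by
    rw [← ZMod.wilsons_lemma p, show p - 1 = 2 * m by lia, ← factorial_mul_prod_odd]
    push_cast
    rfl
  simp only [mul_sub, mul_zero, h2, mul_left_comm _ (s : ZMod p), h3] at h1
  linear_combination h1

/-- The square of Kronecker's product. -/
lemma prod_pow_sub_pow_sq {p m : ℕ} (hpm : p = 2 * m + 1) {ζ : ℂ} (hζ : IsPrimitiveRoot ζ p) :
    (∏ k ∈ Finset.range m, (ζ ^ (2 * k + 1) - ζ ^ (p - (2 * k + 1)))) ^ 2 = (-1) ^ m * p := by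
  have hζ2 : IsPrimitiveRoot (ζ ^ 2) (2 * m + 1) := by
    rw [← hpm]
    refine hζ.pow_of_coprime 2 ?_
    rw [hpm]; simp
  have hz : ζ ^ p = 1 := hζ.pow_eq_one
  have h := hζ2.prod_one_sub_pow_eq_order
  have h1 : ∀ j ∈ Finset.range (2 * m), 1 - (ζ ^ 2) ^ (j + 1) =
      -ζ ^ (j + 1) * (ζ ^ (j + 1) - ζ ^ (p - (j + 1))) := by
    intro j hj
    have hj' : (j + 1) + (p - (j + 1)) = p := by have := Finset.mem_range.1 hj; lia
    have : ζ ^ (j + 1) * ζ ^ (p - (j + 1)) = 1 := by rw [← pow_add, hj', hz]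
    linear_combination -this
  rw [Finset.prod_congr rfl h1, Finset.prod_mul_distrib] at h
  have h2 : ∏ j ∈ Finset.range (2 * m), -ζ ^ (j + 1) = 1 := by
    rw [Finset.prod_neg, Finset.card_range, pow_mul, neg_one_sq, one_pow, one_mul,
      Finset.prod_pow_eq_pow_sum]
    have : ∑ i ∈ Finset.range (2 * m), (i + 1) = p * m := by
      have := Finset.sum_range_succ' (fun i ↦ i) (2 * m)
      have h3 := Finset.sum_range_id_mul_two (2 * m + 1)
      rw [this] at h3
      simp at h3
      rw [hpm]
      linarith
    rw [this, pow_mul, hz, one_pow]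
  rw [h2, one_mul, prod_range_two_mul] at h
  have h3 : ∏ k ∈ Finset.range m, (ζ ^ (2 * k + 1 + 1) - ζ ^ (p - (2 * k + 1 + 1))) =
      (-1) ^ m * ∏ k ∈ Finset.range m, (ζ ^ (2 * k + 1) - ζ ^ (p - (2 * k + 1))) := by
    have hneg := Finset.prod_neg (s := Finset.range m)
      (f := fun k ↦ ζ ^ (2 * k + 1) - ζ ^ (p - (2 * k + 1)))
    rw [Finset.card_range] at hneg
    rw [← Finset.prod_range_reflect, ← hneg]
    refine Finset.prod_congr rfl fun k hk ↦ ?_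
    have := Finset.mem_range.1 hk
    rw [show 2 * (m - 1 - k) + 1 + 1 = p - (2 * k + 1) by lia,
      show p - (p - (2 * k + 1)) = 2 * k + 1 by lia]
    ring
  rw [h3] at h
  have h4 : ((-1 : ℂ) ^ m) ^ 2 = 1 := by rw [← pow_mul, mul_comm, pow_mul]; simp
  have h5 : ((p : ℕ) : ℂ) = ((2 * m : ℕ) : ℂ) + 1 := by rw [hpm]; push_cast; ring
  rw [h5, ← h]
  linear_combination (-(∏ k ∈ Finset.range m, (ζ ^ (2 * k + 1) - ζ ^ (p - (2 * k + 1)))) ^ 2) * h4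

/-- Among the factors `2 sin (2 π (2 k + 1) / p)`, exactly `m / 2` are negative. -/
lemma prod_sin_sign (p m : ℕ) (hpm : p = 2 * m + 1) :
    0 < (-1 : ℝ) ^ (m / 2) *
      ∏ k ∈ Finset.range m, 2 * Real.sin (2 * Real.pi * (2 * k + 1) / p) := by
  have hp : (0 : ℝ) < p := by rw [hpm]; positivity
  have hpi := Real.pi_pos
  obtain ⟨s, hs⟩ : ∃ s, m = s + m / 2 := ⟨m - m / 2, by lia⟩
  conv_rhs => rw [hs, Finset.prod_range_add]
  rw [← hs, mul_left_comm]
  have hneg := Finset.prod_neg (s := Finset.range (m / 2))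
    (f := fun k ↦ 2 * Real.sin (2 * Real.pi * (2 * (s + k : ℕ) + 1) / p))
  rw [Finset.card_range] at hneg
  rw [← hneg]
  refine mul_pos (Finset.prod_pos fun k hk ↦ ?_) (Finset.prod_pos fun k hk ↦ ?_)
  · have hk' : 2 * (2 * k + 1) < p := by have := Finset.mem_range.1 hk; lia
    have hk'' : (2 * (2 * k + 1) : ℝ) < p := by exact_mod_cast hk'
    have := Real.sin_pos_of_pos_of_lt_pi (x := 2 * Real.pi * (2 * k + 1) / p) (by positivity)
      (by rw [div_lt_iff₀ hp]; nlinarith)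
    linarith
  · have hk1 : p < 2 * (2 * (s + k) + 1) := by lia
    have hk2 : 2 * (2 * (s + k) + 1) < 2 * p := by have := Finset.mem_range.1 hk; lia
    have hk1' : (p : ℝ) < 2 * (2 * (s + k : ℕ) + 1) := by exact_mod_cast hk1
    have hk2' : (2 * (2 * (s + k : ℕ) + 1) : ℝ) < 2 * p := by exact_mod_cast hk2
    have := Real.sin_pos_of_pos_of_lt_pi
      (x := 2 * Real.pi * (2 * (s + k : ℕ) + 1) / p - Real.pi)
      (by rw [sub_pos, lt_div_iff₀ hp]; nlinarith)
      (by rw [sub_lt_iff_lt_add, div_lt_iff₀ hp]; nlinarith)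
    rw [Real.sin_sub_pi] at this
    linarith

lemma prod_pow_sub_pow_eq (p m : ℕ) (hpm : p = 2 * m + 1) :
    ∏ k ∈ Finset.range m, (exp (2 * Real.pi * I / p) ^ (2 * k + 1) -
      exp (2 * Real.pi * I / p) ^ (p - (2 * k + 1))) = epsFactor p * Real.sqrt p := by
  have hp : (p : ℂ) ≠ 0 := by exact_mod_cast (by lia : p ≠ 0)
  have hζ := isPrimitiveRoot_exp p (by lia)
  have hsq := prod_pow_sub_pow_sq hpm hζ
  have hfac : ∏ k ∈ Finset.range m, (exp (2 * Real.pi * I / p) ^ (2 * k + 1) -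
      exp (2 * Real.pi * I / p) ^ (p - (2 * k + 1))) =
      I ^ m * (∏ k ∈ Finset.range m, 2 * Real.sin (2 * Real.pi * (2 * k + 1) / p) : ℝ) := by
    have hI : I ^ m = ∏ k ∈ Finset.range m, I := by simp
    rw [hI]
    push_cast
    rw [← Finset.prod_mul_distrib]
    refine Finset.prod_congr rfl fun k hk ↦ ?_
    have hk' : 2 * k + 1 ≤ p := by have := Finset.mem_range.1 hk; lia
    have h2 : exp (2 * Real.pi * I / p) ^ (p - (2 * k + 1)) =
        exp (-(2 * Real.pi * (2 * k + 1) / p * I)) := by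
      rw [← exp_nat_mul, Nat.cast_sub hk', exp_eq_exp_iff_exists_int]
      refine ⟨1, ?_⟩
      push_cast
      field_simp
      ring
    have h1 : exp (2 * Real.pi * I / p) ^ (2 * k + 1) =
        exp (2 * Real.pi * (2 * k + 1) / p * I) := by
      rw [← exp_nat_mul]
      congr 1
      push_cast
      ring
    rw [h1, h2, Complex.sin, neg_mul]
    linear_combination (exp (2 * Real.pi * (2 * k + 1) / p * I) -
      exp (-(2 * Real.pi * (2 * k + 1) / p * I))) * I_sq
  have hpos := prod_sin_sign p m hpm
  rw [hfac] at hsq ⊢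
  set R : ℝ := ∏ k ∈ Finset.range m, 2 * Real.sin (2 * Real.pi * (2 * k + 1) / p)
  have hR : R ^ 2 = p := by
    have h1 : (I ^ m) ^ 2 = (-1) ^ m := by rw [← pow_mul, mul_comm, pow_mul, I_sq]
    rw [mul_pow, h1] at hsq
    exact_mod_cast mul_left_cancel₀ (pow_ne_zero m (by norm_num : (-1 : ℂ) ≠ 0)) hsq
  have hsign : ((-1 : ℝ) ^ (m / 2)) ^ 2 = 1 := by rw [← pow_mul, mul_comm, pow_mul]; simp
  have hsqrt : Real.sqrt p = (-1 : ℝ) ^ (m / 2) * R := by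
    rw [Real.sqrt_eq_iff_mul_self_eq (by positivity) hpos.le, ← hR]
    linear_combination -R ^ 2 * hsign
  have hIm : I ^ m = epsFactor p * (-1) ^ (m / 2) := by
    rw [← I_sq, ← pow_mul]
    unfold epsFactor
    split_ifs with h
    · rw [one_mul]; congr 1; lia
    · rw [← pow_succ']; congr 1; lia
  rw [hsqrt, hIm]
  push_cast
  ring

lemma eN_eq_stdAddChar (q : ℕ) [NeZero q] (x : ℤ) : eN q x = ZMod.stdAddChar (x : ZMod q) :=
  (ZMod.stdAddChar_coe x).symm

/-- The quadratic Gauss sum of the Legendre symbol, with its sign. -/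
lemma sum_legendreSym_mul_stdAddChar (p : ℕ) [Fact p.Prime] (hp2 : p ≠ 2) :
    ∑ x : ZMod p, (quadraticChar (ZMod p) x : ℂ) * ZMod.stdAddChar x =
      epsFactor p * Real.sqrt p := by
  have hp : p.Prime := Fact.out
  obtain ⟨m, hpm⟩ := hp.odd_of_ne_two hp2
  have hζ := isPrimitiveRoot_exp p hp.ne_zero
  set G : ℂ := ∑ x : ZMod p, (quadraticChar (ZMod p) x : ℂ) * ZMod.stdAddChar x with hG
  have hring : ringChar (ZMod p) ≠ 2 := by rwa [ZMod.ringChar_zmod_n]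
  have hGsum : G = ∑ j ∈ Finset.range p,
      (legendreSym p j : ℂ) * exp (2 * Real.pi * I / p) ^ j := by
    rw [hG, ← sum_range_natCast_zmod]
    refine Finset.sum_congr rfl fun j _ ↦ ?_
    have := ZMod.stdAddChar_coe (N := p) j
    rw [Int.cast_natCast] at this
    rw [this, ← exp_nat_mul, legendreSym]
    push_cast
    congr 2
    ring
  have hprod := prod_pow_sub_pow_eq p m hpm
  have hGsq : G ^ 2 = (-1) ^ m * p := by
    have hquad : ((quadraticChar (ZMod p)).ringHomComp (Int.castRingHom ℂ)).IsQuadratic :=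
      (quadraticChar_isQuadratic (ZMod p)).comp _
    have h := gaussSum_sq (χ := (quadraticChar (ZMod p)).ringHomComp (Int.castRingHom ℂ))
      ((MulChar.ringHomComp_ne_one_iff Int.cast_injective).2 (quadraticChar_ne_one hring)) hquad
      (ZMod.isPrimitive_stdAddChar p)
    have hneg : quadraticChar (ZMod p) (-1) = (-1) ^ m := by
      rw [quadraticChar_neg_one hring, ZMod.card, ZMod.χ₄_eq_neg_one_pow (by lia)]
      congr 1; lia
    rw [MulChar.ringHomComp_apply, hneg, ZMod.card] at h
    simpa [gaussSum, hG] using h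
  have hsq := prod_pow_sub_pow_sq hpm hζ
  rw [← hGsq, sq_eq_sq_iff_eq_or_eq_neg] at hsq
  rw [← hprod]
  rcases hsq with h | h
  · exact h.symm
  · exfalso
    have h1 := eq_one_of_sum_legendreSym_eq p m hpm hζ (-1) (by
      rw [← hGsum, h]; simp)
    have : Fact (2 < p) := ⟨by have := hp.two_le; lia⟩
    exact ZMod.neg_one_ne_one (by simpa using h1)

/-- The quadratic Gauss sum as a sum over squares. -/
lemma sum_stdAddChar_mul_sq (p : ℕ) [Fact p.Prime] (hp2 : p ≠ 2) {a : ZMod p} (ha : a ≠ 0) :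
    ∑ x : ZMod p, (ZMod.stdAddChar (a * x ^ 2) : ℂ) =
      quadraticChar (ZMod p) a * (epsFactor p * Real.sqrt p) := by
  have hring : ringChar (ZMod p) ≠ 2 := by rwa [ZMod.ringChar_zmod_n]
  have h1 : ∑ x : ZMod p, (ZMod.stdAddChar (a * x ^ 2) : ℂ) =
      ∑ t : ZMod p, ((quadraticChar (ZMod p) t : ℂ) + 1) * ZMod.stdAddChar (a * t) := by
    rw [← Finset.sum_fiberwise (s := Finset.univ) (g := fun x : ZMod p ↦ x ^ 2)]
    refine Finset.sum_congr rfl fun t _ ↦ ?_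
    rw [Finset.sum_congr rfl (g := fun _ ↦ (ZMod.stdAddChar (a * t) : ℂ))
      (fun x hx ↦ by rw [(Finset.mem_filter.1 hx).2]), Finset.sum_const, nsmul_eq_mul]
    congr 1
    have h := quadraticChar_card_sqrts hring t
    rw [← Int.cast_one, ← Int.cast_add, ← h, Int.cast_natCast]
    congr 2
    ext; simp
  have h2 : ∑ t : ZMod p, (ZMod.stdAddChar (a * t) : ℂ) = 0 := by
    have h := AddChar.sum_mulShift a (ZMod.isPrimitive_stdAddChar p)
    rw [if_neg ha] at h
    simpa [mul_comm] using h
  have h3 : ∑ t : ZMod p, (quadraticChar (ZMod p) t : ℂ) * ZMod.stdAddChar (a * t) =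
      quadraticChar (ZMod p) a *
        ∑ t : ZMod p, (quadraticChar (ZMod p) t : ℂ) * ZMod.stdAddChar t := by
    rw [Finset.mul_sum]
    refine Fintype.sum_bijective (a * ·) (mulLeft_bijective₀ a ha) _ _ fun t ↦ ?_
    have := congrArg (Int.cast : ℤ → ℂ) (quadraticChar_sq_one ha)
    push_cast at this
    rw [map_mul (quadraticChar (ZMod p))]
    push_cast
    linear_combination -(quadraticChar (ZMod p) t * ZMod.stdAddChar (a * t)) * this
  rw [h1]
  simp_rw [add_mul, one_mul]
  rw [Finset.sum_add_distrib, h2, add_zero, h3, sum_legendreSym_mul_stdAddChar p hp2]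

lemma eN_add (q : ℕ) [NeZero q] (x y : ℤ) : eN q (x + y) = eN q x * eN q y := by
  simp [eN_eq_stdAddChar, AddChar.map_add_eq_mul]

lemma eN_congr {q : ℕ} [NeZero q] {x y : ℤ} (h : x ≡ y [ZMOD q]) : eN q x = eN q y := by
  rw [eN_eq_stdAddChar, eN_eq_stdAddChar, (ZMod.intCast_eq_intCast_iff x y q).2 h]

lemma eN_mul_mul {a q : ℕ} (ha : a ≠ 0) (x : ℤ) : eN (a * q) (a * x) = eN q x := by
  have ha' : (a : ℂ) ≠ 0 := by exact_mod_cast ha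
  unfold eN
  push_cast
  rw [mul_left_comm, mul_div_mul_left _ _ ha']

lemma sum_range_eN_mul (q : ℕ) [NeZero q] (a : ℤ) :
    ∑ z ∈ Finset.range q, eN q (a * z) = if (q : ℤ) ∣ a then (q : ℂ) else 0 := by
  have h := AddChar.sum_mulShift (a : ZMod q) (ZMod.isPrimitive_stdAddChar q)
  rw [← sum_range_natCast_zmod q, ZMod.card] at h
  simp_rw [eN_eq_stdAddChar, ← ZMod.intCast_zmod_eq_zero_iff_dvd]
  push_cast
  simp_rw [mul_comm (a : ZMod q), h]
  split_ifs <;> simp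

lemma sum_range_mul_eq_sum_sum {M : Type*} [AddCommMonoid M] (a b : ℕ) (f : ℕ → M) :
    ∑ x ∈ Finset.range (a * b), f x =
      ∑ y ∈ Finset.range a, ∑ z ∈ Finset.range b, f (y + a * z) := by
  induction b with
  | zero => simp
  | succ b ih =>
    rw [mul_add_one, Finset.sum_range_add, ih, ← Finset.sum_add_distrib]
    refine Finset.sum_congr rfl fun y _ ↦ ?_
    rw [Finset.sum_range_succ, add_comm y]

/-- A quadratic exponential sum modulo `p`, evaluated by completing the square. -/
lemma sum_range_eN_linear_sub_sq (p : ℕ) [Fact p.Prime] (hp2 : p ≠ 2) (ℓ b c m : ℤ)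
    (hℓ : ¬ ((p : ℤ) ∣ ℓ)) (hb : 2 * b ≡ 1 [ZMOD p]) (hc : 2 * ℓ * c ≡ 1 [ZMOD p]) :
    ∑ y ∈ Finset.range p, eN p (m * y - ℓ * b * y ^ 2) =
      eN p (c * m ^ 2) * (jacobiSym (-2 * ℓ) p * (epsFactor p * Real.sqrt p)) := by
  have hL : (ℓ : ZMod p) ≠ 0 := by rwa [Ne, ZMod.intCast_zmod_eq_zero_iff_dvd]
  have hB : 2 * (b : ZMod p) = 1 := by exact_mod_cast (ZMod.intCast_eq_intCast_iff _ _ p).2 hb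
  have hC : 2 * (ℓ : ZMod p) * c = 1 := by
    exact_mod_cast (ZMod.intCast_eq_intCast_iff _ _ p).2 hc
  have hB0 : (b : ZMod p) ≠ 0 := by rintro h; simp [h] at hB
  have h20 : (2 : ZMod p) ≠ 0 := by rintro h; simp [h] at hB
  have hA : -((ℓ : ZMod p) * b) ≠ 0 := neg_ne_zero.2 (mul_ne_zero hL hB0)
  have hjac : jacobiSym (-2 * ℓ) p = quadraticChar (ZMod p) (-((ℓ : ZMod p) * b)) := by
    rw [← jacobiSym.legendreSym.to_jacobiSym, legendreSym]
    have : ((-2 * ℓ : ℤ) : ZMod p) = -((ℓ : ZMod p) * b) * 2 ^ 2 := by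
      push_cast
      linear_combination (2 * (ℓ : ZMod p)) * hB
    rw [this, map_mul, quadraticChar_sq_one' h20, mul_one]
  rw [hjac, ← sum_stdAddChar_mul_sq p hp2 hA, Finset.mul_sum]
  have hsq (y : ZMod p) : (m : ZMod p) * y - ℓ * b * y ^ 2 =
      c * m ^ 2 + -((ℓ : ZMod p) * b) * (y - 2 * c * m) ^ 2 := by
    linear_combination (-y * m * 2 * ℓ * c + 2 * c ^ 2 * m ^ 2 * ℓ : ZMod p) * hB
      + (c * m ^ 2 - y * m : ZMod p) * hC
  have h1 : ∀ y ∈ Finset.range p, eN p (m * y - ℓ * b * y ^ 2) = eN p (c * m ^ 2) *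
      ZMod.stdAddChar (-(ℓ * b) * (y - 2 * c * m) ^ 2 : ZMod p) := by
    intro y _
    rw [eN_eq_stdAddChar, eN_eq_stdAddChar, ← AddChar.map_add_eq_mul]
    push_cast
    rw [hsq]
  rw [Finset.sum_congr rfl h1, sum_range_natCast_zmod p (fun y : ZMod p ↦ eN p (c * m ^ 2) *
    ZMod.stdAddChar (-(ℓ * b) * (y - 2 * c * m) ^ 2 : ZMod p))]
  exact Fintype.sum_equiv (Equiv.subRight (2 * (c : ZMod p) * m)) _ _ fun y ↦ rfl

/-- The sum over `1 + p ^ n x` localizes at the stationary point `u ≡ -ℓ (mod p ^ n)`. -/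
lemma sum_range_eN_stationary (p n : ℕ) [Fact p.Prime] (hp2 : p ≠ 2) (ℓ b c u : ℤ)
    (hℓ : ¬ ((p : ℤ) ∣ ℓ)) (hb : 2 * b ≡ 1 [ZMOD p]) (hc : 2 * ℓ * c ≡ 1 [ZMOD p]) :
    ∑ x ∈ Finset.range (p ^ (n + 1)),
        eN (p ^ (n + 1)) ((ℓ + u) * x - ℓ * b * p ^ n * x ^ 2) =
      if ((p ^ n : ℕ) : ℤ) ∣ ℓ + u then (p : ℂ) ^ n * (eN p (c * ((ℓ + u) / (p ^ n : ℤ)) ^ 2) *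
        (jacobiSym (-2 * ℓ) p * (epsFactor p * Real.sqrt p))) else 0 := by
  have hp : p.Prime := Fact.out
  have : NeZero p := ⟨hp.ne_zero⟩
  rw [pow_succ', sum_range_mul_eq_sum_sum]
  have h1 : ∀ y z : ℕ, eN (p * p ^ n) ((ℓ + u) * (y + p * z : ℕ) -
      ℓ * b * p ^ n * (y + p * z : ℕ) ^ 2) =
      eN (p * p ^ n) ((ℓ + u) * y - ℓ * b * p ^ n * y ^ 2) * eN (p ^ n) ((ℓ + u) * z) := by
    intro y z
    rw [← eN_mul_mul (q := p ^ n) hp.ne_zero, ← eN_add]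
    refine eN_congr (Int.modEq_iff_dvd.2 ⟨ℓ * b * (2 * y * z + p * z ^ 2), ?_⟩)
    push_cast
    ring
  simp_rw [h1, ← Finset.mul_sum, sum_range_eN_mul]
  split_ifs with h
  · obtain ⟨m, hm⟩ := h
    push_cast at hm
    have hpn : (p ^ n : ℤ) ≠ 0 := pow_ne_zero _ (by exact_mod_cast hp.ne_zero)
    rw [hm, Int.mul_ediv_cancel_left _ hpn, ← sum_range_eN_linear_sub_sq p hp2 ℓ b c m hℓ hb hc,
      Finset.mul_sum]
    refine Finset.sum_congr rfl fun y _ ↦ ?_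
    rw [← eN_mul_mul (q := p) (pow_ne_zero n hp.ne_zero), mul_comm p]
    push_cast
    rw [mul_comm]
    congr 2
    ring
  · simp

lemma isUnit_one_add_pow_mul (p n : ℕ) (hn : 1 ≤ n) (x : ℤ) :
    IsUnit ((1 + p ^ n * x : ℤ) : ZMod (p ^ (2 * n + 1))) := by
  push_cast
  refine IsNilpotent.isUnit_one_add ⟨2 * n + 1, ?_⟩
  have h : (p : ZMod (p ^ (2 * n + 1))) ^ (2 * n + 1) = 0 := by
    rw [← Nat.cast_pow, ZMod.natCast_self]
  rw [mul_pow, ← pow_mul, mul_comm n, pow_mul, h, zero_pow (by lia), zero_mul]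

/-- The summand at a stationary point does not depend on that point. -/
lemma stationary_summand_eq (p n : ℕ) (hp : p.Prime) (hn : 1 ≤ n)
    (χ : DirichletCharacter ℂ (p ^ (2 * n + 1)))
    (ℓ b c : ℤ) (hℓ : ¬ ((p : ℤ) ∣ ℓ)) (hb : 2 * b ≡ 1 [ZMOD p])
    (hpost : ∀ x : ℤ, χ ((1 + p ^ n * x : ℤ) : ZMod (p ^ (2 * n + 1))) =
      eN (p ^ (n + 1)) (ℓ * (x - b * p ^ n * x ^ 2)))
    (hc : 2 * ℓ * c ≡ 1 [ZMOD p]) {t₀ u : ℤ} (ht₀ : ((p ^ n : ℕ) : ℤ) ∣ ℓ + t₀)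
    (hu : ((p ^ n : ℕ) : ℤ) ∣ ℓ + u) :
    χ (u : ZMod (p ^ (2 * n + 1))) * eN (p ^ (2 * n + 1)) u *
        eN p (c * ((ℓ + u) / (p ^ n : ℤ)) ^ 2) =
      χ (t₀ : ZMod (p ^ (2 * n + 1))) * eN (p ^ (2 * n + 1)) t₀ *
        eN p (c * ((ℓ + t₀) / (p ^ n : ℤ)) ^ 2) := by
  have : NeZero p := ⟨hp.ne_zero⟩
  have hpn : (p ^ n : ℤ) ≠ 0 := pow_ne_zero _ (by exact_mod_cast hp.ne_zero)
  obtain ⟨m₀, hm₀⟩ := ht₀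
  obtain ⟨m, hm⟩ := hu
  push_cast at hm₀ hm
  have hpdvd : (p : ℤ) ∣ p ^ n := dvd_pow_self _ (by lia)
  have hcop : IsCoprime (t₀ : ℤ) ((p : ℤ) ^ (2 * n + 1)) := by
    refine (IsCoprime.pow_left ?_).symm
    refine (Nat.prime_iff_prime_int.1 hp).coprime_iff_not_dvd.2 fun h ↦ hℓ ?_
    rw [← add_sub_cancel_right ℓ t₀, hm₀]
    exact dvd_sub (hpdvd.mul_right _) h
  obtain ⟨s, w, hsw⟩ := hcop
  have hut : u = t₀ + p ^ n * (m - m₀) := by linear_combination hm - hm₀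
  have hfac : u ≡ t₀ * (1 + p ^ n * (s * (m - m₀))) [ZMOD (p ^ (2 * n + 1) : ℕ)] := by
    refine Int.modEq_iff_dvd.2 ⟨-(w * p ^ n * (m - m₀)), ?_⟩
    push_cast
    rw [hut]
    linear_combination (p ^ n * (m - m₀)) * hsw
  set x := s * (m - m₀) with hx
  have hsplit : p ^ (2 * n + 1) = p ^ n * p ^ (n + 1) := by rw [← pow_add]; congr 1; lia
  have hχu : χ (u : ZMod (p ^ (2 * n + 1))) = χ (t₀ : ZMod (p ^ (2 * n + 1))) *
      eN (p ^ (n + 1)) (ℓ * (x - b * p ^ n * x ^ 2)) := by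
    rw [(ZMod.intCast_eq_intCast_iff _ _ _).2 hfac, Int.cast_mul, map_mul, hpost]
  have heu : eN (p ^ (2 * n + 1)) u = eN (p ^ (2 * n + 1)) t₀ * eN (p ^ (n + 1)) (t₀ * x) := by
    rw [eN_congr hfac, ← eN_mul_mul (q := p ^ (n + 1)) (pow_ne_zero n hp.ne_zero), ← hsplit,
      ← eN_add]
    congr 1
    push_cast
    ring
  have hquad : eN (p ^ (n + 1)) (ℓ * (x - b * p ^ n * x ^ 2)) * eN (p ^ (n + 1)) (t₀ * x) =
      eN p (m₀ * x - ℓ * b * x ^ 2) := by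
    rw [← eN_add, ← eN_mul_mul (q := p) (pow_ne_zero n hp.ne_zero), ← pow_succ]
    congr 1
    push_cast
    linear_combination x * hm₀
  have hm_eq : (m : ZMod p) = m₀ - ℓ * x := by
    have h1 : (s : ZMod p) * t₀ = 1 := by
      have := congrArg (Int.cast : ℤ → ZMod p) hsw
      simpa using this
    have h2 : (ℓ : ZMod p) + t₀ = 0 := by
      have := congrArg (Int.cast : ℤ → ZMod p) hm₀
      simpa [zero_pow (by lia : n ≠ 0)] using this
    rw [hx]
    push_cast
    linear_combination (s * (m - m₀) : ZMod p) * h2 - (m - m₀ : ZMod p) * h1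
  have hB : 2 * (b : ZMod p) = 1 := by exact_mod_cast (ZMod.intCast_eq_intCast_iff _ _ p).2 hb
  have hC : 2 * (ℓ : ZMod p) * c = 1 := by
    exact_mod_cast (ZMod.intCast_eq_intCast_iff _ _ p).2 hc
  have hfin : eN p (m₀ * x - ℓ * b * x ^ 2) * eN p (c * m ^ 2) = eN p (c * m₀ ^ 2) := by
    rw [← eN_add]
    refine eN_congr ((ZMod.intCast_eq_intCast_iff _ _ p).1 ?_)
    push_cast
    rw [hm_eq]
    have hBC : (c : ZMod p) * ℓ = b := by
      linear_combination b * hC - (c * ℓ : ZMod p) * hB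
    linear_combination (ℓ * x ^ 2 : ZMod p) * hBC - (m₀ * x : ZMod p) * hC
  rw [hm, hm₀, Int.mul_ediv_cancel_left _ hpn, Int.mul_ediv_cancel_left _ hpn, hχu, heu, ← hfin,
    ← hquad]
  ring

/-- Among the residues modulo `a * k`, exactly `k` lie in a given class modulo `a`. -/
lemma sum_range_ite_dvd_add (a k : ℕ) (ha : 0 < a) (ℓ : ℤ) :
    ∑ j ∈ Finset.range (a * k), (if (a : ℤ) ∣ ℓ + j then (1 : ℂ) else 0) = k := by
  have ha' : (a : ℤ) ≠ 0 := by exact_mod_cast ha.ne'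
  have h0 := Int.emod_nonneg (-ℓ) ha'
  have h1 := Int.emod_lt_of_pos (-ℓ) (by exact_mod_cast ha : (0 : ℤ) < a)
  have hmem : ((-ℓ) % a).toNat ∈ Finset.range a := by simp; lia
  have hdvd (y : ℕ) : (a : ℤ) ∣ ℓ + y ↔ -ℓ ≡ y [ZMOD a] := by
    rw [Int.modEq_iff_dvd, sub_neg_eq_add, add_comm]
  rw [sum_range_mul_eq_sum_sum, Finset.sum_eq_single_of_mem _ hmem]
  · rw [Finset.sum_congr rfl (g := fun _ ↦ (1 : ℂ)), Finset.sum_const]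
    · simp
    · intro z _
      rw [if_pos]
      rw [hdvd]
      push_cast
      rw [Int.toNat_of_nonneg h0]
      simp [Int.ModEq]
  · intro y hy hne
    refine Finset.sum_eq_zero fun z _ ↦ if_neg fun h ↦ hne ?_
    rw [hdvd, Int.ModEq] at h
    have hy' := Finset.mem_range.1 hy
    rw [h]
    push_cast
    rw [Int.add_mul_emod_self_left, Int.emod_eq_of_lt (by lia) (by lia)]
    simp

/-- Evaluation of the Gauss sum of a primitive character of odd prime power conductor. -/
theorem gauss_sum_eval_odd_exponent (p n : ℕ) (hp : p.Prime) (hp5 : 5 ≤ p) (hn : 1 ≤ n)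
    (χ : DirichletCharacter ℂ (p ^ (2 * n + 1))) (hχ : χ.IsPrimitive)
    (ℓ b c : ℤ) (hℓ : ¬ ((p : ℤ) ∣ ℓ)) (hb : 2 * b ≡ 1 [ZMOD (p ^ (n + 1) : ℕ)])
    (hpost : ∀ x : ℤ, χ ((1 + p ^ n * x : ℤ) : ZMod (p ^ (2 * n + 1))) =
      eN (p ^ (n + 1)) (ℓ * (x - b * p ^ n * x ^ 2)))
    (hc : 2 * ℓ * c ≡ 1 [ZMOD (p : ℕ)]) :
    ∀ t₀ : ℤ, t₀ ≡ -ℓ [ZMOD (p ^ n : ℕ)] →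
      haveI : NeZero (p ^ (2 * n + 1)) := ⟨pow_ne_zero _ hp.ne_zero⟩
      (∑ t : ZMod (p ^ (2 * n + 1)), χ t * eN (p ^ (2 * n + 1)) (t.val : ℤ)) =
        epsFactor p * (p : ℂ) ^ n * Real.sqrt p * jacobiSym (-2 * ℓ) p *
          χ ((t₀ : ℤ) : ZMod (p ^ (2 * n + 1))) * eN (p ^ (2 * n + 1)) t₀ *
          eN p (c * ((ℓ + t₀) / (p ^ n : ℤ)) ^ 2) := by
  intro t₀ ht₀
  have : Fact p.Prime := ⟨hp⟩
  have : NeZero p := ⟨hp.ne_zero⟩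
  have hN : NeZero (p ^ (2 * n + 1)) := ⟨pow_ne_zero _ hp.ne_zero⟩
  have hp2 : p ≠ 2 := by lia
  have hbp : 2 * b ≡ 1 [ZMOD p] :=
    hb.of_dvd (by exact_mod_cast dvd_pow_self p (Nat.succ_ne_zero n))
  have ht₀' : ((p ^ n : ℕ) : ℤ) ∣ ℓ + t₀ := by
    have := Int.modEq_iff_dvd.1 ht₀.symm
    rwa [sub_neg_eq_add, add_comm] at this
  have hsplit : p ^ (2 * n + 1) = p ^ n * p ^ (n + 1) := by rw [← pow_add]; congr 1; lia
  have heN (t : ZMod (p ^ (2 * n + 1))) :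
      eN (p ^ (2 * n + 1)) (t.val : ℤ) = ZMod.stdAddChar t := by
    simp [eN_eq_stdAddChar]
  simp_rw [heN]
  set τ : ℂ := ∑ t : ZMod (p ^ (2 * n + 1)), χ t * ZMod.stdAddChar t with hτ
  have htwist (x : ℤ) : τ = ∑ j ∈ Finset.range (p ^ (2 * n + 1)),
      χ ((j : ℤ) : ZMod (p ^ (2 * n + 1))) * eN (p ^ (2 * n + 1)) j *
        eN (p ^ (n + 1)) ((ℓ + j) * x - ℓ * b * p ^ n * x ^ 2) := by
    have hbij : Function.Bijective
        (· * ((1 + p ^ n * x : ℤ) : ZMod (p ^ (2 * n + 1)))) :=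
      IsUnit.isUnit_iff_mulRight_bijective.1 (isUnit_one_add_pow_mul p n hn x)
    rw [hτ, ← Function.Bijective.sum_comp hbij (fun t ↦ χ t * ZMod.stdAddChar t),
      ← sum_range_natCast_zmod]
    refine Finset.sum_congr rfl fun j _ ↦ ?_
    have h1 : (ZMod.stdAddChar
        ((j : ZMod (p ^ (2 * n + 1))) * ((1 + p ^ n * x : ℤ) : ZMod (p ^ (2 * n + 1)))) : ℂ) =
        eN (p ^ (2 * n + 1)) j * eN (p ^ (n + 1)) (j * x) := by
      rw [← eN_mul_mul (q := p ^ (n + 1)) (pow_ne_zero n hp.ne_zero), ← hsplit, ← eN_add,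
        eN_eq_stdAddChar]
      congr 1
      push_cast
      ring
    have h2 : eN (p ^ (n + 1)) ((ℓ + j) * x - ℓ * b * p ^ n * x ^ 2) =
        eN (p ^ (n + 1)) (ℓ * (x - b * p ^ n * x ^ 2)) * eN (p ^ (n + 1)) (j * x) := by
      rw [← eN_add]
      congr 1
      ring
    rw [map_mul χ, hpost, h1, h2, Int.cast_natCast]
    ring
  have hsum : (p : ℂ) ^ (n + 1) * τ = ∑ x ∈ Finset.range (p ^ (n + 1)), τ := by simp
  have hpc : (p : ℂ) ^ (n + 1) ≠ 0 := pow_ne_zero _ (by exact_mod_cast hp.ne_zero)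
  refine mul_left_cancel₀ hpc ?_
  rw [hsum, Finset.sum_congr rfl fun (x : ℕ) (_ : x ∈ Finset.range (p ^ (n + 1))) ↦ htwist x,
    Finset.sum_comm]
  set K : ℂ := χ (t₀ : ZMod (p ^ (2 * n + 1))) * eN (p ^ (2 * n + 1)) t₀ *
    eN p (c * ((ℓ + t₀) / (p ^ n : ℤ)) ^ 2) with hK
  have hterm : ∀ j ∈ Finset.range (p ^ (2 * n + 1)), ∑ x ∈ Finset.range (p ^ (n + 1)),
      χ ((j : ℤ) : ZMod (p ^ (2 * n + 1))) * eN (p ^ (2 * n + 1)) j *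
        eN (p ^ (n + 1)) ((ℓ + j) * (x : ℤ) - ℓ * b * p ^ n * (x : ℤ) ^ 2) =
      (p : ℂ) ^ n * (jacobiSym (-2 * ℓ) p * (epsFactor p * Real.sqrt p)) * K *
        if ((p ^ n : ℕ) : ℤ) ∣ ℓ + j then 1 else 0 := by
    intro j _
    rw [← Finset.mul_sum, sum_range_eN_stationary p n hp2 ℓ b c j hℓ hbp hc]
    split_ifs with h
    · rw [hK, ← stationary_summand_eq p n hp hn χ ℓ b c hℓ hbp hpost hc ht₀' h]
      ring
    · simp
  have hcount := sum_range_ite_dvd_add _ (p ^ (n + 1)) (pow_pos hp.pos n) ℓ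
  rw [← hsplit] at hcount
  rw [Finset.sum_congr rfl hterm, ← Finset.mul_sum, hcount, hK]
  push_cast
  ring
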